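/- Let p be a prime, d ≥ 1, q = p^d, and n ≥ 1. Let K be an algebraically closed field with char K ≠ p. Then there is a K-algebra isomorphism between the group algebras K[GL_n(𝔽_q[t]/t²)] and K[GL_n(W₂(𝔽_q))], where 𝔽_q[t]/t² is realized as the ring of dual numbers DualNumber (GaloisField p d) and W₂(𝔽_q) is the ring of Witt vectors of length two, TruncatedWittVector p 2 (GaloisField p d). -/

import Mathlib

open Matrix

/-- A commutative ring `R` that is an extension of the field `k` by a one-dimensional square-zero
ideal, generated by `unif`, together with a multiplicative section of the residue map. -/
structure LengthTwoData (R k : Type*) [CommRing R] [Field k] where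
  /-- The residue map. -/
  res : R →+* k
  /-- A generator of the maximal ideal. -/
  unif : R
  /-- A multiplicative section of the residue map. -/
  teich : k →*₀ R
  res_teich : ∀ x, res (teich x) = x
  res_eq_zero_iff : ∀ r, res r = 0 ↔ ∃ y, r = unif * y
  unif_mul_eq_zero_iff : ∀ y, unif * y = 0 ↔ res y = 0

namespace LengthTwoData

variable {R k n : Type*} [CommRing R] [Field k] [Fintype n] [DecidableEq n]
  (D : LengthTwoData R k)

lemma unif_mul_unif : D.unif * D.unif = 0 :=
  (D.unif_mul_eq_zero_iff _).2 ((D.res_eq_zero_iff _).2 ⟨1, by simp⟩)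

lemma res_unif : D.res D.unif = 0 := (D.res_eq_zero_iff _).2 ⟨1, by simp⟩

lemma isUnit_of_res_ne_zero {r : R} (h : D.res r ≠ 0) : IsUnit r := by
  obtain ⟨y, hy⟩ := (D.res_eq_zero_iff (r * D.teich (D.res r)⁻¹ - 1)).1 (by
    simp [D.res_teich, h])
  refine IsUnit.of_mul_eq_one (D.teich (D.res r)⁻¹ * (1 - D.unif * y)) ?_
  have := D.unif_mul_unif
  linear_combination (1 - D.unif * y) * hy - y ^ 2 * this

/-- The entrywise residue map on matrices. -/
def mres : Matrix n n R →+* Matrix n n k := D.res.mapMatrix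

lemma mres_apply (M : Matrix n n R) (i j : n) : D.mres M i j = D.res (M i j) := rfl

lemma mres_eq_zero_iff (M : Matrix n n R) : D.mres M = 0 ↔ ∃ Y, M = D.unif • Y := by
  constructor
  · intro h
    have h' : ∀ i j, ∃ y, M i j = D.unif * y := fun i j =>
      (D.res_eq_zero_iff _).1 (congrFun (congrFun h i) j)
    choose Y hY using h'
    exact ⟨Matrix.of Y, by ext i j; simp [hY]⟩
  · rintro ⟨Y, rfl⟩
    ext i j
    simp [mres_apply, res_unif]

lemma unif_smul_eq_zero_iff (M : Matrix n n R) : D.unif • M = 0 ↔ D.mres M = 0 := by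
  simp only [← Matrix.ext_iff, Matrix.smul_apply, smul_eq_mul, Matrix.zero_apply,
    D.unif_mul_eq_zero_iff, mres_apply]

lemma unif_smul_eq_iff (M N : Matrix n n R) : D.unif • M = D.unif • N ↔ D.mres M = D.mres N := by
  rw [← sub_eq_zero, ← smul_sub, unif_smul_eq_zero_iff, map_sub, sub_eq_zero]

lemma unif_smul_mul (M N : Matrix n n R) : (D.unif • M) * (D.unif • N) = 0 := by
  rw [smul_mul_smul_comm, unif_mul_unif, zero_smul]

lemma one_add_mul_one_add (M N : Matrix n n R) :
    (1 + D.unif • M) * (1 + D.unif • N) = 1 + D.unif • (M + N) := by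
  rw [add_mul, one_mul, mul_add, mul_one, unif_smul_mul, smul_add]
  abel

lemma mres_one_add (M : Matrix n n R) : D.mres (1 + D.unif • M) = 1 := by
  rw [map_add, map_one, (D.mres_eq_zero_iff _).2 ⟨M, rfl⟩, add_zero]

lemma exists_one_add_of_mres_eq_one {M : Matrix n n R} (h : D.mres M = 1) :
    ∃ Y, M = 1 + D.unif • Y := by
  obtain ⟨Y, hY⟩ := (D.mres_eq_zero_iff (M - 1)).1 (by simp [h])
  exact ⟨Y, by rw [← hY]; abel⟩

lemma isUnit_of_isUnit_mres {M : Matrix n n R} (h : IsUnit (D.mres M)) : IsUnit M := by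
  rw [Matrix.isUnit_iff_isUnit_det] at h ⊢
  refine D.isUnit_of_res_ne_zero ?_
  rw [RingHom.map_det]
  exact h.ne_zero

/-- The entrywise Teichmüller lift of a matrix. -/
def mteich (M : Matrix n n k) : Matrix n n R := M.map D.teich

@[simp] lemma mres_mteich (M : Matrix n n k) : D.mres (D.mteich M) = M := by
  ext i j
  simp [mres_apply, mteich, D.res_teich]

lemma mres_surjective : Function.Surjective (D.mres : Matrix n n R → Matrix n n k) :=
  fun M => ⟨_, D.mres_mteich M⟩

omit [Fintype n] in
@[simp] lemma mteich_one : D.mteich (1 : Matrix n n k) = 1 := by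
  simp [mteich]

lemma isUnit_mteich {M : Matrix n n k} (h : IsUnit M) : IsUnit (D.mteich M) :=
  D.isUnit_of_isUnit_mres (by simpa)

/-- The character `1 + ϖ Y ↦ tr (A Y)` extends to a homomorphism on the invertible matrices whose
residue lies in `C`. -/
def TraceExtends (C : Set (Matrix n n k)) (A : Matrix n n k) : Prop :=
  ∃ F : Matrix n n R → k, (∀ Y, F (1 + D.unif • Y) = (A * D.mres Y).trace) ∧
    ∀ g h, IsUnit g → IsUnit h → D.mres g ∈ C → D.mres h ∈ C → F (g * h) = F g + F h

namespace TraceExtends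

variable {D} {C : Set (Matrix n n k)} {A B : Matrix n n k}

lemma mono {C' : Set (Matrix n n k)} (hA : D.TraceExtends C A) (h : C' ⊆ C) :
    D.TraceExtends C' A := by
  obtain ⟨F, hF, hF'⟩ := hA
  exact ⟨F, hF, fun g g' hg hg' hgC hgC' => hF' g g' hg hg' (h hgC) (h hgC')⟩

lemma zero : D.TraceExtends C 0 := ⟨0, by simp, by simp⟩

lemma add (hA : D.TraceExtends C A) (hB : D.TraceExtends C B) : D.TraceExtends C (A + B) := by
  obtain ⟨F, hF, hF'⟩ := hA
  obtain ⟨G, hG, hG'⟩ := hB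
  refine ⟨F + G, fun Y => ?_, fun g h hg hh hgC hhC => ?_⟩
  · simp [hF, hG, add_mul]
  · simp only [Pi.add_apply, hF' g h hg hh hgC hhC, hG' g h hg hh hgC hhC]
    abel

lemma smul (hA : D.TraceExtends C A) (c : k) : D.TraceExtends C (c • A) := by
  obtain ⟨F, hF, hF'⟩ := hA
  refine ⟨c • F, fun Y => ?_, fun g h hg hh hgC hhC => ?_⟩
  · simp [hF]
  · simp [hF' g h hg hh hgC hhC, mul_add]

lemma sum {ι : Type*} (s : Finset ι) (f : ι → Matrix n n k)
    (h : ∀ i ∈ s, D.TraceExtends C (f i)) : D.TraceExtends C (∑ i ∈ s, f i) := by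
  classical
  induction s using Finset.induction_on with
  | empty => simpa using zero
  | insert a s ha ih =>
    rw [Finset.sum_insert ha]
    exact (h a (by simp)).add (ih fun i hi => h i (by simp [hi]))

/-- Conjugation invariance of the extension property. -/
lemma conj {P Q : Matrix n n k} (hPQ : P * Q = 1)
    (hA : D.TraceExtends {X | Commute X A} A) :
    D.TraceExtends {X | Commute X (P * A * Q)} (P * A * Q) := by
  have hQP : Q * P = 1 := mul_eq_one_comm.1 hPQ
  obtain ⟨F, hF, hF'⟩ := hA
  obtain ⟨P', hP'⟩ := D.isUnit_mteich (IsUnit.of_mul_eq_one _ hPQ)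
  have hP : D.mres P' = P := by simp [hP']
  have hQ : D.mres (P'⁻¹).1 = Q := by
    have : D.mres (P'⁻¹).1 * P = 1 := by
      rw [← hP, ← map_mul]; simp
    calc _ = D.mres (P'⁻¹).1 * (P * Q) := by rw [hPQ, mul_one]
      _ = Q := by rw [← mul_assoc, this, one_mul]
  have key : ∀ X, Commute X (P * A * Q) → Commute (Q * X * P) A := by
    intro X hX
    have h := congrArg (fun Z => Q * Z * P) hX.eq
    have e1 : Q * (X * (P * A * Q)) * P = Q * X * P * A * (Q * P) := by simp only [mul_assoc]
    have e2 : Q * (P * A * Q * X) * P = (Q * P) * A * (Q * X * P) := by simp only [mul_assoc]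
    simp only [e1, e2, hQP, mul_one, one_mul] at h
    exact h
  refine ⟨fun g => F ((P'⁻¹).1 * g * P'), fun Y => ?_, fun g h hg hh hgC hhC => ?_⟩
  · have : (P'⁻¹).1 * (1 + D.unif • Y) * P'
        = 1 + D.unif • ((P'⁻¹).1 * Y * P') := by
      rw [mul_add, add_mul]; simp
    simp only
    rw [this, hF, map_mul, map_mul, hP, hQ, ← mul_assoc, ← mul_assoc, Matrix.trace_mul_comm]
    simp only [mul_assoc]
  · have : (P'⁻¹).1 * (g * h) * P' = ((P'⁻¹).1 * g * P') * ((P'⁻¹).1 * h * P') := by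
      simp [mul_assoc]
    simp only
    rw [this]
    refine hF' _ _ ((P'⁻¹.isUnit.mul hg).mul P'.isUnit) ((P'⁻¹.isUnit.mul hh).mul P'.isUnit) ?_ ?_
    · simpa only [Set.mem_ofPred_eq, map_mul, hP, hQ] using key _ hgC
    · simpa only [Set.mem_ofPred_eq, map_mul, hP, hQ] using key _ hhC

end TraceExtends

/-- The logarithm `R → k`, sending `x (1 + ϖ y)` with `x` a Teichmüller lift to the residue of
`y`. -/
lemma exists_log : ∃ l : R → k, (∀ y, l (1 + D.unif * y) = D.res y) ∧
    ∀ u v, D.res u ≠ 0 → D.res v ≠ 0 → l (u * v) = l u + l v := by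
  have h : ∀ u, ∃ y, D.res u ≠ 0 → u * D.teich (D.res u)⁻¹ = 1 + D.unif * y := by
    intro u
    by_cases hu : D.res u = 0
    · exact ⟨0, fun h => absurd hu h⟩
    · obtain ⟨y, hy⟩ := (D.res_eq_zero_iff (u * D.teich (D.res u)⁻¹ - 1)).1
        (by simp [D.res_teich, hu])
      exact ⟨y, fun _ => by rw [← hy]; ring⟩
  choose l hl using h
  have uniq : ∀ x y, D.unif * x = D.unif * y → D.res x = D.res y := fun x y hxy => by
    rw [← sub_eq_zero, ← map_sub, ← D.unif_mul_eq_zero_iff, mul_sub, hxy, sub_self]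
  refine ⟨fun u => D.res (l u), fun y => ?_, fun u v hu hv => ?_⟩
  · have h1 : D.res (1 + D.unif * y) = 1 := by simp [D.res_unif]
    have := hl (1 + D.unif * y) (by simp [h1])
    rw [h1, inv_one, map_one, mul_one] at this
    exact (uniq _ _ (add_left_cancel this)).symm
  · have h1 := hl _ hu
    have h2 := hl _ hv
    have h3 := hl (u * v) (by simp [hu, hv])
    rw [map_mul, mul_inv, map_mul] at h3
    rw [← map_add]
    refine uniq _ _ ?_
    have := D.unif_mul_unif
    linear_combination (-1 : R) * h3 + h1 * (v * D.teich (D.res v)⁻¹) + (1 + D.unif * l u) * h2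
      + l u * l v * this

/-- Extension for idempotent matrices, by means of a determinant on a lift of the image. -/
lemma traceExtends_of_isIdempotentElem {E : Matrix n n k} (hE : IsIdempotentElem E) :
    D.TraceExtends {X | Commute X E} E := by
  obtain ⟨e, he, rfl⟩ := exists_isIdempotentElem_eq_of_ker_isNilpotent
    (D.mres : Matrix n n R →+* Matrix n n k) (fun x hx => by
      obtain ⟨Y, rfl⟩ := (D.mres_eq_zero_iff x).1 hx
      exact ⟨2, by rw [sq, unif_smul_mul]⟩) E (D.mres_surjective E) hE
  obtain ⟨l, hl, hl'⟩ := D.exists_log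
  have he' : e * e = e := he
  refine ⟨fun g => l (e * g * e + (1 - e)).det, fun Y => ?_, fun g h hg hh hgC hhC => ?_⟩
  · have : e * (1 + D.unif • Y) * e + (1 - e) = 1 + D.unif • (e * Y * e) := by
      rw [mul_add, add_mul, mul_one, he']
      simp only [mul_smul_comm, smul_mul_assoc]
      abel
    simp only
    rw [this, Matrix.det_one_add_smul, sq, D.unif_mul_unif, mul_zero, add_zero, mul_comm, hl,
      Matrix.trace_mul_comm, ← mul_assoc, he', ← map_mul]
    simp only [Matrix.trace, Matrix.diag_apply, mres_apply, map_sum]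
  · have hne : ∀ g, IsUnit g → Commute (D.mres g) (D.mres e) →
        D.res (e * g * e + (1 - e)).det ≠ 0 := by
      rintro _ ⟨g, rfl⟩ hc
      rw [RingHom.map_det]
      refine IsUnit.ne_zero ?_
      rw [← Matrix.isUnit_iff_isUnit_det]
      change IsUnit (D.mres _)
      refine IsUnit.of_mul_eq_one (D.mres (e * (g⁻¹).1 * e + (1 - e))) ?_
      have hgg : D.mres (g : Matrix n n R) * D.mres (g⁻¹).1 = 1 := by
        rw [← map_mul]; simp
      have hee : D.mres e * D.mres e = D.mres e := by rw [← map_mul, he']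
      simp only [map_add, map_mul, map_sub, map_one]
      generalize D.mres (g : Matrix n n R) = a at *
      generalize D.mres (g⁻¹).1 = b at *
      generalize D.mres e = x at *
      have hxa : x * a * x = a * x := by rw [← hc.eq, mul_assoc, hee]
      have h1 : x * a * x * (x * b * x) = x := by
        calc x * a * x * (x * b * x) = (x * a) * (x * x) * b * x := by simp only [mul_assoc]
          _ = x * (a * b) * x := by rw [hee, hxa, hc.eq]; simp only [mul_assoc]
          _ = x := by rw [hgg, mul_one, hee]
      have h2 : x * a * x * (1 - x) = 0 := by rw [mul_sub, mul_one, mul_assoc _ x x, hee, sub_self]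
      have h3 : (1 - x) * (x * b * x) = 0 := by
        rw [sub_mul, one_mul, ← mul_assoc, ← mul_assoc, hee, sub_self]
      have h4 : (1 - x) * (1 - x) = 1 - x := IsIdempotentElem.one_sub hee
      rw [add_mul, mul_add, mul_add, h1, h2, h3, h4]
      abel
    have hmul : (e * (g * h) * e + (1 - e)).det =
        (e * g * e + (1 - e)).det * (e * h * e + (1 - e)).det := by
      rw [← Matrix.det_mul]
      congr 1
      obtain ⟨Y, hY⟩ := (D.mres_eq_zero_iff (e * g * (1 - e))).1 (by
        have : Commute (D.mres g) (D.mres e) := hgC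
        rw [map_mul, map_mul, ← this.eq, mul_assoc, ← map_mul, mul_sub, he', mul_one, sub_self,
          map_zero, mul_zero])
      obtain ⟨Z, hZ⟩ := (D.mres_eq_zero_iff ((1 - e) * h * e)).1 (by
        have : Commute (D.mres h) (D.mres e) := hhC
        rw [mul_assoc, map_mul, map_mul, this.eq, ← mul_assoc, ← map_mul, sub_mul, he', one_mul,
          sub_self, map_zero, zero_mul])
      have h4 : (1 - e) * (1 - e) = 1 - e := he.one_sub
      have h0 : e * g * (1 - e) * h * e = 0 := by
        have : e * g * ((1 - e) * (1 - e)) * h * e = 0 := by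
          have := D.unif_smul_mul Y Z
          rw [← hY, ← hZ] at this
          simpa only [mul_assoc] using this
        rwa [h4] at this
      have h1 : e * g * e * (e * h * e) = e * (g * h) * e := by
        have : e * g * (1 - e) * h * e = e * (g * h) * e - e * g * e * h * e := by noncomm_ring
        rw [h0] at this
        rw [sub_eq_zero.1 this.symm]
        calc e * g * e * (e * h * e) = e * g * (e * e) * h * e := by simp only [mul_assoc]
          _ = _ := by rw [he']
      have h2 : e * g * e * (1 - e) = 0 := by rw [mul_sub, mul_one, mul_assoc _ e e, he', sub_self]
      have h3 : (1 - e) * (e * h * e) = 0 := by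
        rw [sub_mul, one_mul, ← mul_assoc, ← mul_assoc, he', sub_self]
      rw [add_mul, mul_add, mul_add, h1, h2, h3, h4]
      abel
    simp only
    rw [hmul]
    exact hl' _ _ (hne _ hg hgC) (hne _ hh hhC)

/-- A matrix with at most one nonzero entry in each row and each column. -/
def _root_.Matrix.IsSubmonomial (J : Matrix n n k) : Prop :=
  (∀ j, ∃ i, ∀ i', i' ≠ i → J i' j = 0) ∧ ∀ i, ∃ j, ∀ j', j' ≠ j → J i j' = 0

omit [DecidableEq n] in
lemma mteich_mul_right {J : Matrix n n k} (hJ : J.IsSubmonomial) (X : Matrix n n k) :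
    D.mteich (X * J) = D.mteich X * D.mteich J := by
  ext i j
  obtain ⟨l, hl⟩ := hJ.1 j
  simp only [mteich, Matrix.map_apply, Matrix.mul_apply]
  rw [Finset.sum_eq_single l (fun b _ hb => by simp [hl b hb]) (by simp),
    Finset.sum_eq_single l (fun b _ hb => by simp [hl b hb]) (by simp), map_mul]

omit [DecidableEq n] in
lemma mteich_mul_left {J : Matrix n n k} (hJ : J.IsSubmonomial) (X : Matrix n n k) :
    D.mteich (J * X) = D.mteich J * D.mteich X := by
  ext i j
  obtain ⟨l, hl⟩ := hJ.2 i
  simp only [mteich, Matrix.map_apply, Matrix.mul_apply]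
  rw [Finset.sum_eq_single l (fun b _ hb => by simp [hl b hb]) (by simp),
    Finset.sum_eq_single l (fun b _ hb => by simp [hl b hb]) (by simp), map_mul]

omit [DecidableEq n] in
lemma commute_mteich {J X : Matrix n n k} (hJ : J.IsSubmonomial) (h : Commute X J) :
    Commute (D.mteich X) (D.mteich J) := by
  rw [Commute, SemiconjBy, ← D.mteich_mul_right hJ, ← D.mteich_mul_left hJ, h.eq]

/-- Extension for nilpotent matrices in Jordan form: it may be chosen trivial on the
Teichmüller lifts. -/
lemma traceExtends_of_isSubmonomial {J : Matrix n n k} (hJ : J.IsSubmonomial)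
    (hn : IsNilpotent J) : D.TraceExtends {X | Commute X J} J := by
  have h : ∀ g : Matrix n n R, ∃ Y, IsUnit g → g = (1 + D.unif • Y) * D.mteich (D.mres g) := by
    intro g
    by_cases hg : IsUnit g
    · obtain ⟨u, hu⟩ := D.isUnit_mteich (hg.map D.mres)
      obtain ⟨Y, hY⟩ := D.exists_one_add_of_mres_eq_one (M := g * (u⁻¹).1) (by
        have : D.mres (u : Matrix n n R) = D.mres g := by simp [hu]
        rw [map_mul, ← this, ← map_mul]; simp)
      exact ⟨Y, fun _ => by rw [← hY, ← hu]; simp⟩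
    · exact ⟨0, fun h => absurd h hg⟩
  choose L hL using h
  refine ⟨fun g => (J * D.mres (L g)).trace, fun Y => ?_, fun g h hg hh hgC hhC => ?_⟩
  · have h1 := D.mres_one_add Y
    have := hL _ (D.isUnit_of_isUnit_mres (h1 ▸ isUnit_one))
    rw [h1, mteich_one, mul_one] at this
    simp only
    rw [(D.unif_smul_eq_iff _ _).1 (add_left_cancel this)]
  · obtain ⟨a, ha⟩ := D.isUnit_mteich (hg.map D.mres)
    obtain ⟨b, hb⟩ := D.isUnit_mteich (hh.map D.mres)
    obtain ⟨c, hc⟩ := D.isUnit_mteich ((hg.mul hh).map D.mres)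
    have haJ := ha ▸ D.commute_mteich hJ hgC
    have hbJ := hb ▸ D.commute_mteich hJ hhC
    have hghC : Commute (D.mres (g * h)) J := by
      rw [map_mul]; exact Commute.mul_left hgC hhC
    have hcJ := hc ▸ D.commute_mteich hJ hghC
    have hg' := hL g hg
    have hh' := hL h hh
    have hgh' := hL (g * h) (hg.mul hh)
    rw [← ha] at hg'
    rw [← hb] at hh'
    rw [← hc] at hgh'
    have hares : D.mres (a : Matrix n n R) = D.mres g := by simp [ha]
    obtain ⟨Z, hZ⟩ := D.exists_one_add_of_mres_eq_one (M := a.1 * b.1 * (c⁻¹).1) (by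
      have : D.mres (c : Matrix n n R) = D.mres (a * b : Matrix n n R) := by simp [hc, ha, hb]
      rw [map_mul, ← this, ← map_mul]; simp)
    have hZJ : Commute (D.mres Z) J := by
      have h1 : Commute (1 + D.unif • Z) (D.mteich J) := by
        rw [← hZ]
        exact (haJ.mul_left hbJ).mul_left hcJ.units_inv_left
      have h2 : D.unif • (Z * D.mteich J) = D.unif • (D.mteich J * Z) := by
        have := h1.eq
        rw [add_mul, mul_add, one_mul, mul_one, smul_mul_assoc, mul_smul_comm] at this
        exact add_left_cancel this
      simpa [Commute, SemiconjBy] using (D.unif_smul_eq_iff _ _).1 h2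
    have hab : (a * b : Matrix n n R) = (1 + D.unif • Z) * c := by rw [← hZ]; simp
    have key : g * h = (1 + D.unif • (L g + (a * L h * (a⁻¹).1 + Z))) * c := by
      rw [← D.one_add_mul_one_add, ← D.one_add_mul_one_add, mul_assoc, mul_assoc, ← hab]
      conv_lhs => rw [hg', hh']
      have : (a : Matrix n n R) * (1 + D.unif • L h) = (1 + D.unif • (a * L h * (a⁻¹).1)) * a := by
        rw [mul_add, add_mul]; simp
      rw [mul_assoc, ← mul_assoc (a : Matrix n n R), this]
      simp only [mul_assoc]
    have hL' : D.mres (L (g * h)) = D.mres (L g + (a.1 * L h * (a⁻¹).1 + Z)) := by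
      rw [← D.unif_smul_eq_iff]
      refine add_left_cancel (a := 1) (c.isUnit.mul_right_cancel ?_)
      rw [← hgh', key]
    have htr : (J * D.mres Z).trace = 0 := by
      refine (Matrix.isNilpotent_trace_of_isNilpotent ?_).eq_zero
      exact hZJ.symm.isNilpotent_mul_right hn
    have hconj : (J * D.mres (a * L h * (a⁻¹).1 : Matrix n n R)).trace = (J * D.mres (L h)).trace := by
      have h1 : Commute (D.mres (a : Matrix n n R)) J := hares ▸ hgC
      rw [map_mul, map_mul, ← mul_assoc, ← mul_assoc, ← h1.eq, Matrix.trace_mul_comm,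
        ← mul_assoc, ← mul_assoc, ← map_mul]
      simp
    simp only
    rw [hL', map_add, map_add, mul_add, mul_add, Matrix.trace_add, Matrix.trace_add, hconj, htr,
      add_zero]

end LengthTwoData

open Polynomial in
lemma Polynomial.exists_basis_quotient_X_pow (k : Type*) [Field k] (e : ℕ) :
    ∃ b : Module.Basis (Fin e) k (k[X] ⧸ (k[X] ∙ (X ^ e : k[X]))),
      ∀ j : Fin e, (X : k[X]) • b j = if h : j + 1 < e then b ⟨j + 1, h⟩ else 0 := by
  have hd : (X ^ e : k[X]).natDegree = e := natDegree_X_pow e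
  let g : k[X] := X ^ e
  have hg : g.Monic := monic_X_pow e
  let φ : AdjoinRoot g ≃ₗ[k] (k[X] ⧸ (k[X] ∙ (X ^ e : k[X]))) := LinearEquiv.refl k (AdjoinRoot g)
  have hφ : ∀ q, φ (AdjoinRoot.mk g q) = Submodule.Quotient.mk q := fun q => rfl
  have hB : ∀ j, (AdjoinRoot.powerBasis' hg).basis j = AdjoinRoot.mk g (X ^ (j : ℕ)) := by
    intro j
    rw [PowerBasis.coe_basis, AdjoinRoot.powerBasis'_gen, map_pow, AdjoinRoot.mk_X]
  have hb : ∀ j : Fin e, (((AdjoinRoot.powerBasis' hg).basis.reindex (finCongr hd)).map φ) j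
      = Submodule.Quotient.mk (X ^ (j : ℕ)) := by
    intro j
    rw [Module.Basis.map_apply, Module.Basis.reindex_apply, hB, hφ]
    rfl
  obtain ⟨b, hb⟩ : ∃ b : Module.Basis (Fin e) k (k[X] ⧸ (k[X] ∙ (X ^ e : k[X]))),
    ∀ j, b j = Submodule.Quotient.mk (X ^ (j : ℕ)) := ⟨_, hb⟩
  refine ⟨b, fun j => ?_⟩
  rw [hb, ← Submodule.Quotient.mk_smul, smul_eq_mul, ← pow_succ']
  split_ifs with h
  · rw [hb]
  · rw [show (j + 1 : ℕ) = e by omega, Submodule.Quotient.mk_eq_zero]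
    exact Submodule.mem_span_singleton_self _

open Polynomial in
/-- Jordan normal form of a nilpotent endomorphism. -/
lemma Module.End.exists_basis_of_isNilpotent {k V : Type*} [Field k] [AddCommGroup V] [Module k V]
    [FiniteDimensional k V] {f : Module.End k V} (hf : IsNilpotent f) :
    ∃ (d : ℕ) (e : Fin d → ℕ) (b : Module.Basis (Σ i, Fin (e i)) k V), ∀ i j,
      f (b ⟨i, j⟩) = if h : j + 1 < e i then b ⟨i, j + 1, h⟩ else 0 := by
  classical
  have htors : Module.IsTorsion' (Module.AEval' f) (Submonoid.powers (X : k[X])) := by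
    obtain ⟨m, hm⟩ := hf
    intro x
    obtain ⟨v, rfl⟩ := (Module.AEval'.of f).surjective x
    refine ⟨⟨X ^ m, m, rfl⟩, ?_⟩
    change (X ^ m : k[X]) • Module.AEval'.of f v = 0
    rw [Module.AEval'.X_pow_smul_of, hm]
    simp
  have : Module.Finite k[X] (Module.AEval' f) := inferInstance
  obtain ⟨d, e, ⟨E⟩⟩ := Module.torsion_by_prime_power_decomposition irreducible_X htors
  choose B hB using fun i => Polynomial.exists_basis_quotient_X_pow k (e i)
  have hb : ∀ i j, DFinsupp.basis B ⟨i, j⟩ = DFinsupp.single i (B i j) := by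
    intro i j
    apply (DFinsupp.basis B).repr.injective
    rw [Module.Basis.repr_self]
    ext ⟨i', j'⟩
    change _ = (B i').repr ((DFinsupp.single i (B i j) : Π₀ i, k[X] ⧸ (k[X] ∙ (X ^ e i : k[X]))) i') j'
    by_cases h : i = i'
    · subst h
      rw [DFinsupp.single_eq_same, Module.Basis.repr_self, Finsupp.single_apply,
        Finsupp.single_apply]
      simp
    · rw [DFinsupp.single_eq_of_ne (Ne.symm h), map_zero, Finsupp.single_apply, if_neg]
      · rfl
      · rintro ⟨⟩
        exact h rfl
  let b := ((DFinsupp.basis B).map (E.restrictScalars k).symm).map (Module.AEval'.of f).symm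
  have hEb : ∀ i j, E (Module.AEval'.of f (b ⟨i, j⟩)) = DirectSum.of _ i (B i j) := by
    intro i j
    simp only [b, Module.Basis.map_apply, LinearEquiv.apply_symm_apply, hb]
    exact (E.restrictScalars k).apply_symm_apply _
  refine ⟨d, e, b, fun i j => ?_⟩
  apply (Module.AEval'.of f).injective
  rw [← Module.AEval'.X_smul_of]
  apply E.injective
  rw [map_smul, hEb, ← DirectSum.lof_eq_of k[X], ← map_smul, hB]
  split_ifs with h
  · rw [hEb, ← DirectSum.lof_eq_of k[X]]
  · simp

/-- Every nilpotent matrix is conjugate to a nilpotent submonomial one. -/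
lemma Matrix.exists_conj_isSubmonomial_of_isNilpotent {k n : Type*} [Field k] [Fintype n]
    [DecidableEq n] {N : Matrix n n k} (hN : IsNilpotent N) :
    ∃ P Q J : Matrix n n k, P * Q = 1 ∧ J.IsSubmonomial ∧ IsNilpotent J ∧ N = P * J * Q := by
  obtain ⟨d, e, b', hb'⟩ := Module.End.exists_basis_of_isNilpotent
    (hN.map (Matrix.toLinAlgEquiv' (R := k) (n := n)))
  let σ : (Σ i, Fin (e i)) ≃ n := b'.indexEquiv (Pi.basisFun k n)
  let b := b'.reindex σ
  set f := Matrix.toLinAlgEquiv' N with hf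
  have hJ : ∀ i j, LinearMap.toMatrix b b f i j = b'.repr (f (b' (σ.symm j))) (σ.symm i) := by
    intro i j
    simp [LinearMap.toMatrix_apply, b]
  have hcol : ∀ i j, b'.repr (f (b' j)) i ≠ 0 → i.1 = j.1 ∧ (i.2 : ℕ) = j.2 + 1 := by
    rintro i ⟨j1, j2⟩ h
    rw [hb'] at h
    split_ifs at h with h'
    · rw [Module.Basis.repr_self, Finsupp.single_apply] at h
      have := (ite_ne_right_iff.1 h).1
      subst this
      exact ⟨rfl, rfl⟩
    · simp at h
  have ext' : ∀ x y : Σ i, Fin (e i), x.1 = y.1 → (x.2 : ℕ) = y.2 → x = y := by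
    rintro ⟨x, x'⟩ ⟨y, y'⟩ h h'
    simp only at h
    subst h
    simpa [Fin.ext_iff] using h'
  refine ⟨(Pi.basisFun k n).toMatrix b, b.toMatrix (Pi.basisFun k n), LinearMap.toMatrix b b f,
    Module.Basis.toMatrix_mul_toMatrix_flip _ _, ⟨fun j => ?_, fun i => ?_⟩, ?_, ?_⟩
  · by_cases h : ∃ i, LinearMap.toMatrix b b f i j ≠ 0
    · obtain ⟨i, hi⟩ := h
      refine ⟨i, fun i' hi' => ?_⟩
      by_contra hne
      rw [hJ] at hi hne
      have h1 := hcol _ _ hi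
      have h2 := hcol _ _ hne
      exact hi' (σ.symm.injective (ext' _ _ (h2.1.trans h1.1.symm) (h2.2.trans h1.2.symm)))
    · push Not at h
      exact ⟨j, fun i _ => h i⟩
  · by_cases h : ∃ j, LinearMap.toMatrix b b f i j ≠ 0
    · obtain ⟨j, hj⟩ := h
      refine ⟨j, fun j' hj' => ?_⟩
      by_contra hne
      rw [hJ] at hj hne
      have h1 := hcol _ _ hj
      have h2 := hcol _ _ hne
      exact hj' (σ.symm.injective (ext' _ _ (h2.1.symm.trans h1.1) (by omega)))
    · push Not at h
      exact ⟨i, fun j _ => h j⟩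
  · exact (hN.map (Matrix.toLinAlgEquiv' (R := k) (n := n))).map (LinearMap.toMatrixAlgEquiv b)
  · rw [basis_toMatrix_mul_linearMap_toMatrix_mul_basis_toMatrix]
    have : LinearMap.toMatrix (Pi.basisFun k n) (Pi.basisFun k n) f = LinearMap.toMatrix' f := by
      rw [LinearMap.toMatrix_eq_toMatrix']
    rw [this, hf]
    exact (LinearMap.toMatrix'_toLin' N).symm

open Polynomial in
/-- A matrix with split squarefree minimal polynomial is a linear combination of idempotents that
are polynomials in it. -/
lemma Matrix.exists_eq_sum_smul_aeval_of_squarefree {k n : Type*} [Field k] [IsAlgClosed k]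
    [Fintype n] [DecidableEq n] {S : Matrix n n k} (hS : Squarefree (minpoly k S)) :
    ∃ (s : Finset k) (p : k → k[X]), S = ∑ x ∈ s, x • aeval S (p x) ∧
      ∀ x ∈ s, IsIdempotentElem (aeval S (p x)) := by
  classical
  let s := (minpoly k S).roots.toFinset
  have hagree : ∀ P Q : k[X], (∀ x ∈ s, P.eval x = Q.eval x) → aeval S P = aeval S Q := by
    intro P Q h
    rw [← sub_eq_zero, ← map_sub, ← minpoly.dvd_iff]
    have hsplit := IsAlgClosed.splits (minpoly k S)
    have hmon := minpoly.monic (Matrix.isIntegral S)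
    by_cases hPQ : P - Q = 0
    · rw [hPQ]; exact dvd_zero _
    rw [hsplit.eq_prod_roots_of_monic hmon, Multiset.prod_X_sub_C_dvd_iff_le_roots hPQ,
      Multiset.le_iff_subset (nodup_roots (PerfectField.separable_iff_squarefree.2 hS))]
    intro x hx
    rw [mem_roots hPQ, IsRoot, eval_sub, h x (by simpa [s] using hx), sub_self]
  let p : k → k[X] := fun x => Lagrange.interpolate s id (Pi.single x 1)
  have hp : ∀ x, ∀ y ∈ s, (p x).eval y = Pi.single (M := fun _ => k) x 1 y := fun x y hy =>
    Lagrange.eval_interpolate_at_node _ (Function.injective_id.injOn) hy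
  refine ⟨s, p, ?_, fun x _ => ?_⟩
  · have := hagree X (∑ x ∈ s, C x * p x) (fun y hy => by
      simp only [eval_X, eval_finsetSum, eval_mul, eval_C]
      rw [Finset.sum_eq_single y (fun b hb hby => by rw [hp _ _ hy, Pi.single_eq_of_ne hby.symm,
        mul_zero]) (by simp [hy]), hp _ _ hy, Pi.single_eq_same, mul_one])
    rw [aeval_X] at this
    conv_lhs => rw [this]
    simp [Algebra.smul_def]
  · rw [IsIdempotentElem, ← map_mul]
    refine hagree _ _ fun y hy => ?_
    rw [eval_mul, hp _ _ hy]
    by_cases h : y = x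
    · subst h; simp
    · simp [h]

namespace LengthTwoData

variable {R k n : Type*} [CommRing R] [Field k] [Fintype n] [DecidableEq n]
  (D : LengthTwoData R k)

lemma traceExtends_of_isNilpotent {N : Matrix n n k} (hN : IsNilpotent N) :
    D.TraceExtends {X | Commute X N} N := by
  obtain ⟨P, Q, J, hPQ, hJ, hJn, rfl⟩ := Matrix.exists_conj_isSubmonomial_of_isNilpotent hN
  exact (D.traceExtends_of_isSubmonomial hJ hJn).conj hPQ

open Polynomial in
lemma traceExtends_of_squarefree_minpoly [IsAlgClosed k] {S : Matrix n n k}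
    (hS : Squarefree (minpoly k S)) : D.TraceExtends {X | Commute X S} S := by
  obtain ⟨s, p, hs, hp⟩ := Matrix.exists_eq_sum_smul_aeval_of_squarefree hS
  have : D.TraceExtends {X | Commute X S} (∑ x ∈ s, x • aeval S (p x)) :=
    .sum _ _ fun x hx => .smul ((D.traceExtends_of_isIdempotentElem (hp x hx)).mono
      fun X (hX : Commute X S) => ?_) x
  · rwa [← hs] at this
  · exact Algebra.commute_of_mem_adjoin_singleton_of_commute (aeval_mem_adjoin_singleton k S) hX

/-- Over an algebraically closed field, every character of the congruence kernel extends to its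
stabilizer. -/
theorem traceExtends [IsAlgClosed k] (A : Matrix n n k) : D.TraceExtends {X | Commute X A} A := by
  let φ := Matrix.toLinAlgEquiv' (R := k) (n := n)
  obtain ⟨N, hN, S, hS, hNn, hSs, hA⟩ :=
    Module.End.exists_isNilpotent_isSemisimple (f := φ A)
  have hadj : ∀ T ∈ Algebra.adjoin k {φ A}, ∀ X, Commute X A → Commute X (φ.symm T) := by
    intro T hT X hX
    have : Commute (φ X) T :=
      Algebra.commute_of_mem_adjoin_singleton_of_commute hT (hX.map φ)
    simpa using this.map φ.symm
  have hA' : A = φ.symm N + φ.symm S := by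
    rw [← map_add, ← hA, AlgEquiv.symm_apply_apply]
  have hsq : Squarefree (minpoly k (φ.symm S)) := by
    rw [minpoly.algEquiv_eq]
    exact hSs.minpoly_squarefree
  have := ((D.traceExtends_of_isNilpotent (hNn.map φ.symm)).mono (hadj N hN)).add
    ((D.traceExtends_of_squarefree_minpoly hsq).mono (hadj S hS))
  rwa [← hA'] at this

end LengthTwoData

/-- A multiplicative cocycle on `G` with values in the functions on a `Γ`-set. -/
structure MonomialCocycle (K : Type*) {G Γ M : Type*} [Field K] [Group G] [Group Γ]
    (π : G →* Γ) (act : Γ →* Equiv.Perm M) where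
  /-- The underlying function. -/
  toFun : G → M → K
  map_one : ∀ A, toFun 1 A = 1
  map_mul : ∀ g h A, toFun (g * h) A = toFun g (act (π h) A) * toFun h A

namespace MonomialCocycle

variable {K G Γ M : Type*} [Field K] [Group G] [Group Γ] {π : G →* Γ} {act : Γ →* Equiv.Perm M}
  (f : MonomialCocycle K π act)

lemma toFun_ne_zero (g : G) (A : M) : f.toFun g A ≠ 0 := by
  intro h
  have := f.map_mul g⁻¹ g A
  rw [inv_mul_cancel, f.map_one, h, mul_zero] at this
  exact one_ne_zero this

variable [Fintype M] [DecidableEq M]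

/-- The monomial representation attached to a cocycle, twisted by the group algebra of `Γ`. -/
noncomputable def rep : G →* Matrix M M (MonoidAlgebra K Γ) where
  toFun g := of fun B A => if B = act (π g) A then .single (π g) (f.toFun g A) else 0
  map_one' := by
    ext B A : 2
    by_cases h : B = A <;> simp [f.map_one, Matrix.one_apply, MonoidAlgebra.one_def, h]
  map_mul' g h := by
    ext B A : 2
    rw [Matrix.mul_apply, Finset.sum_eq_single (act (π h) A)]
    · simp [f.map_mul, MonoidAlgebra.single_mul_single]
    · intro C _ hC
      simp [hC]
    · simp

lemma rep_apply (g : G) (B A : M) :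
    f.rep g B A = if B = act (π g) A then .single (π g) (f.toFun g A) else 0 := rfl

/-- The extension of `MonomialCocycle.rep` to the group algebra. -/
noncomputable def repAlg : MonoidAlgebra K G →ₐ[K] Matrix M M (MonoidAlgebra K Γ) :=
  MonoidAlgebra.lift K _ G f.rep

lemma repAlg_injective [Finite G]
    (hf : LinearIndependent K fun u : π.ker => f.toFun u) : Function.Injective f.repAlg := by
  classical
  have := Fintype.ofFinite G
  rw [injective_iff_map_eq_zero]
  intro x hx
  rw [Fintype.linearIndependent_iff] at hf
  ext g₀
  have key := hf (fun u => x.coeff (u * g₀)) (by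
    ext B
    obtain ⟨A, rfl⟩ := (act (π g₀)).surjective B
    have h := congrArg (fun Y : MonoidAlgebra K Γ => Y.coeff (π g₀))
      (congrFun (congrFun hx (act (π g₀) A)) A)
    simp only [repAlg, MonoidAlgebra.lift_apply] at h
    rw [Finsupp.sum_fintype _ _ (by simp)] at h
    simp only [Matrix.sum_apply, Matrix.smul_apply, rep_apply, Matrix.zero_apply,
      MonoidAlgebra.coeff_sum, MonoidAlgebra.coeff_zero, Finsupp.finsetSum_apply, MonoidAlgebra.coeff_smul,
      Finsupp.smul_apply, Finsupp.zero_apply, smul_eq_mul] at h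
    have h2 : ∀ g, (x.coeff g * (if act (π g₀) A = act (π g) A
        then MonoidAlgebra.single (π g) (f.toFun g A) else 0 : MonoidAlgebra K Γ).coeff (π g₀))
        = if π g = π g₀ then x.coeff g * f.toFun g A else 0 := by
      intro g
      by_cases hg : π g = π g₀
      · simp [hg]
      · by_cases hA : act (π g₀) A = act (π g) A <;> simp [hg, hA]
    simp only [h2] at h
    rw [← Equiv.sum_comp (Equiv.mulRight g₀)] at h
    simp only [Equiv.coe_mulRight, f.map_mul] at h
    rw [← Finset.sum_filter, Finset.sum_subtype (p := (· ∈ π.ker)) _ (by simp [MonoidHom.mem_ker])] at h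
    have h0 := f.toFun_ne_zero g₀ A
    refine mul_right_cancel₀ h0 ?_
    simp only [Finset.sum_apply, Pi.smul_apply, smul_eq_mul, Pi.zero_apply, Finset.sum_mul, zero_mul,
      mul_assoc]
    exact h) 1
  simpa using key

variable (K act) in
/-- The span of the elementary matrices supporting the monomial representations. -/
noncomputable def supportSpan : Submodule K (Matrix M M (MonoidAlgebra K Γ)) :=
  Submodule.span K (Set.range fun x : Γ × M =>
    Matrix.single (act x.1 x.2) x.2 (MonoidAlgebra.single x.1 (1 : K)))

lemma repAlg_mem (x : MonoidAlgebra K G) : f.repAlg x ∈ supportSpan K act := by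
  rw [repAlg, MonoidAlgebra.lift_apply]
  refine Submodule.sum_mem _ fun g _ => Submodule.smul_mem _ _ ?_
  have : f.rep g = ∑ A, f.toFun g A • Matrix.single (act (π g) A) A
      (MonoidAlgebra.single (π g) (1 : K)) := by
    ext B A : 2
    rw [Matrix.sum_apply, Finset.sum_eq_single A]
    · by_cases h : B = act (π g) A
      · simp [rep_apply, h]
      · simp [rep_apply, h, Ne.symm h]
    · intro C _ hC
      simp [hC]
    · simp
  rw [this]
  exact Submodule.sum_mem _ fun A _ => Submodule.smul_mem _ _
    (Submodule.subset_span ⟨(π g, A), rfl⟩)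

lemma range_repAlg [Finite G] [Finite Γ]
    (hf : LinearIndependent K fun u : π.ker => f.toFun u)
    (hcard : Nat.card Γ * Nat.card M ≤ Nat.card G) :
    LinearMap.range f.repAlg.toLinearMap = supportSpan K act := by
  have := Fintype.ofFinite G
  have := Fintype.ofFinite Γ
  have : FiniteDimensional K (supportSpan K act) :=
    FiniteDimensional.span_of_finite K (Set.finite_range _)
  refine Submodule.eq_of_le_of_finrank_le ?_ ?_
  · rintro _ ⟨x, rfl⟩
    exact f.repAlg_mem x
  · rw [LinearMap.finrank_range_of_inj (f.repAlg_injective hf)]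
    refine (finrank_range_le_card _).trans ?_
    rw [Fintype.card_prod, ← Nat.card_eq_fintype_card, ← Nat.card_eq_fintype_card]
    refine hcard.trans_eq ?_
    rw [Module.finrank_eq_nat_card_basis (MonoidAlgebra.basis G K)]

/-- Group algebras admitting large enough families of cocycles over the same permutation action
are isomorphic. -/
theorem nonempty_algEquiv {G' : Type*} [Group G'] {π' : G' →* Γ} [Finite G] [Finite G'] [Finite Γ]
    (f : MonomialCocycle K π act) (f' : MonomialCocycle K π' act)
    (hf : LinearIndependent K fun u : π.ker => f.toFun u)
    (hf' : LinearIndependent K fun u : π'.ker => f'.toFun u)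
    (hcard : Nat.card Γ * Nat.card M ≤ Nat.card G)
    (hcard' : Nat.card Γ * Nat.card M ≤ Nat.card G') :
    Nonempty (MonoidAlgebra K G ≃ₐ[K] MonoidAlgebra K G') := by
  have h : f.repAlg.range = f'.repAlg.range := by
    apply Subalgebra.toSubmodule_injective
    have h1 := f.range_repAlg hf hcard
    have h2 := f'.range_repAlg hf' hcard'
    ext x
    have := congrArg (x ∈ ·) (h1.trans h2.symm)
    simpa using this
  exact ⟨(AlgEquiv.ofInjective _ (f.repAlg_injective hf)).trans <|
    (Subalgebra.equivOfEq _ _ h).trans (AlgEquiv.ofInjective _ (f'.repAlg_injective hf')).symm⟩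

omit [Fintype M] [DecidableEq M] in
/-- Characters of the stabilizers induce a cocycle. -/
lemma exists_of_stabilizer_characters (π : G →* Γ) (act : Γ →* Equiv.Perm M)
    (χ : M → G → K)
    (hχ₁ : ∀ A, χ A 1 = 1)
    (hχ : ∀ A g h, act (π g) A = A → act (π h) A = A → χ A (g * h) = χ A g * χ A h) :
    ∃ f : MonomialCocycle K π act, ∀ A, ∃ A₀ u, act (π u) A₀ = A ∧
      ∀ g, π g = 1 → f.toFun g A = χ A₀ (u⁻¹ * g * u) := by
  let s : Setoid M := ⟨fun A B => ∃ g, act (π g) A = B, fun A => ⟨1, by simp⟩,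
    fun {A B} ⟨g, h⟩ => ⟨g⁻¹, by simp [← h]⟩,
    fun {A B C} ⟨g, h⟩ ⟨g', h'⟩ => ⟨g' * g, by simp [h, h']⟩⟩
  let r : M → M := fun A => (Quotient.mk s A).out
  have hr : ∀ A, ∃ u, act (π u) (r A) = A := fun A => Quotient.mk_out (s := s) A
  have hr' : ∀ A g, r (act (π g) A) = r A := fun A g =>
    congrArg Quotient.out (Quotient.sound (s := s) ⟨g⁻¹, by simp⟩)
  choose u hu using hr
  have hu' : ∀ A, (act (π (u A)))⁻¹ A = r A := fun A => by
    rw [Equiv.Perm.inv_eq_iff_eq, hu]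
  have hstab : ∀ g A, act (π ((u (act (π g) A))⁻¹ * g * u A)) (r A) = r A := fun g A => by
    simp only [_root_.map_mul, map_inv, Equiv.Perm.mul_apply, hu, hu', hr']
  refine ⟨⟨fun g A => χ (r A) ((u (act (π g) A))⁻¹ * g * u A), fun A => ?_, fun g h A => ?_⟩,
    fun A => ⟨r A, u A, hu A, fun g hg => ?_⟩⟩
  · simp [hχ₁]
  · rw [hr', ← hχ]
    · simp [mul_assoc]
    · simpa only [hr'] using hstab g (act (π h) A)
    · exact hstab h A
  · simp [hg]

end MonomialCocycle

/-- The conjugation action of invertible matrices on all matrices. -/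
def Matrix.conjPerm (k n : Type*) [Field k] [Fintype n] [DecidableEq n] :
    (Matrix n n k)ˣ →* Equiv.Perm (Matrix n n k) where
  toFun γ := ⟨fun A => γ.1 * A * γ⁻¹.1, fun A => γ⁻¹.1 * A * γ.1,
    fun A => by simp [mul_assoc], fun A => by simp [mul_assoc]⟩
  map_one' := by ext; simp
  map_mul' γ δ := by ext1 A; simp [mul_assoc]

lemma Matrix.conjPerm_apply {k n : Type*} [Field k] [Fintype n] [DecidableEq n]
    (γ : (Matrix n n k)ˣ) (A : Matrix n n k) :
    Matrix.conjPerm k n γ A = γ.1 * A * γ⁻¹.1 := rfl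

namespace LengthTwoData

variable {R k n : Type*} [CommRing R] [Field k] [Fintype n] [DecidableEq n]
  (D : LengthTwoData R k)

/-- The residue map on general linear groups. -/
def unitsRes : (Matrix n n R)ˣ →* (Matrix n n k)ˣ := Units.map D.mres.toMonoidHom

@[simp] lemma val_unitsRes (g : (Matrix n n R)ˣ) : (D.unitsRes g).1 = D.mres g.1 := rfl

@[simp] lemma val_inv_unitsRes (g : (Matrix n n R)ˣ) :
    (D.unitsRes g)⁻¹.1 = D.mres (g⁻¹).1 := rfl

lemma exists_cocycle {R' k' K : Type*} [CommRing R'] [Field k'] [IsAlgClosed k'] [Field K]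
    (D' : LengthTwoData R' k') (φ : R →+* R') (ι : k →+* k')
    (hres : ∀ r, D'.res (φ r) = ι (D.res r)) (hunif : φ D.unif = D'.unif) (ψ : AddChar k' K) :
    ∃ f : MonomialCocycle K (D.unitsRes (n := n)) (Matrix.conjPerm k n), ∀ g A Y,
      g.1 = 1 + D.unif • Y → f.toFun g A = ψ (ι (A * D.mres Y).trace) := by
  have hmres : ∀ X : Matrix n n R, D'.mres (φ.mapMatrix X) = ι.mapMatrix (D.mres X) := fun X => by
    ext i j
    simp [mres_apply, hres]
  have hφ : ∀ Y : Matrix n n R,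
      φ.mapMatrix (1 + D.unif • Y) = 1 + D'.unif • φ.mapMatrix Y := fun Y => by
    rw [map_add, map_one]
    congr 1
    ext i j
    simp [hunif]
  choose F hF hF' using fun A : Matrix n n k => D'.traceExtends (ι.mapMatrix A)
  have hcomm : ∀ (A : Matrix n n k) (g : (Matrix n n R)ˣ),
      Matrix.conjPerm k n (D.unitsRes g) A = A →
      Commute (D'.mres (φ.mapMatrix g.1)) (ι.mapMatrix A) := fun A g h => by
    rw [hmres]
    refine Commute.map ?_ ι.mapMatrix
    rw [conjPerm_apply, Units.mul_inv_eq_iff_eq_mul] at h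
    exact h
  obtain ⟨f, hf⟩ := MonomialCocycle.exists_of_stabilizer_characters (D.unitsRes (n := n))
    (Matrix.conjPerm k n) (fun A g => ψ (F A (φ.mapMatrix g.1)))
    (fun A => by
      have := hF A 0
      simp only [smul_zero, add_zero, map_zero, mul_zero, Matrix.trace_zero] at this
      simp only [Units.val_one, map_one, this, AddChar.map_zero_eq_one])
    (fun A g h hg hh => by
      rw [Units.val_mul, map_mul, hF' A _ _ (g.isUnit.map _) (h.isUnit.map _) (hcomm A g hg)
        (hcomm A h hh), AddChar.map_add_eq_mul])
  refine ⟨f, fun g A Y hg => ?_⟩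
  obtain ⟨A₀, u, rfl, hu⟩ := hf A
  rw [hu g (by ext1; simp [hg, mres_one_add])]
  have : (u⁻¹ * g * u).1 = 1 + D.unif • ((u⁻¹).1 * Y * u.1) := by
    simp [hg, mul_add, add_mul]
  have htr : ∀ X : Matrix n n k, (ι.mapMatrix X).trace = ι X.trace := fun X =>
    (AddMonoidHom.map_trace (ι : k →+ k') X).symm
  rw [this, hφ, hF, hmres, ← map_mul, htr, conjPerm_apply, val_unitsRes, val_inv_unitsRes,
    map_mul, map_mul, mul_assoc, mul_assoc, mul_assoc (D.mres u.1),
    Matrix.trace_mul_comm (D.mres u.1)]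
  simp only [mul_assoc]

lemma linearIndependent_cocycle {K : Type*} [Field K] (ψ : AddChar k K) (hψ : ∃ c, ψ c ≠ 1)
    (f : MonomialCocycle K (D.unitsRes (n := n)) (Matrix.conjPerm k n))
    (hf : ∀ g A Y, g.1 = 1 + D.unif • Y → f.toFun g A = ψ (A * D.mres Y).trace) :
    LinearIndependent K fun u : (D.unitsRes (n := n)).ker => f.toFun u := by
  have hY : ∀ u : (D.unitsRes (n := n)).ker, ∃ Y, u.1.1 = 1 + D.unif • Y := fun u =>
    D.exists_one_add_of_mres_eq_one (congrArg Units.val u.2)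
  choose Y hY using hY
  let e : (D.unitsRes (n := n)).ker → (Multiplicative (Matrix n n k) →* K) := fun u =>
    AddChar.toMonoidHom (ψ.compAddMonoidHom
      ((Matrix.traceAddMonoidHom n k).comp (AddMonoidHom.mulRight (D.mres (Y u)))))
  have he : ∀ u A, e u (Multiplicative.ofAdd A) = ψ (A * D.mres (Y u)).trace := fun u A => rfl
  have hinj : Function.Injective e := by
    intro u v huv
    obtain ⟨c, hc⟩ := hψ
    have h : D.mres (Y u) = D.mres (Y v) := by
      by_contra hne
      rw [← sub_eq_zero] at hne
      obtain ⟨i, j, hij⟩ : ∃ i j, (D.mres (Y u) - D.mres (Y v)) i j ≠ 0 := by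
        by_contra! h
        exact hne (Matrix.ext h)
      apply hc
      let A := Matrix.single j i (c / (D.mres (Y u) - D.mres (Y v)) i j)
      have h1 := DFunLike.congr_fun huv (Multiplicative.ofAdd A)
      rw [he, he] at h1
      have h2 : (A * (D.mres (Y u) - D.mres (Y v))).trace = c := by
        rw [Matrix.trace_single_mul]
        exact div_mul_cancel₀ c hij
      rw [← h2, mul_sub, Matrix.trace_sub, AddChar.map_sub_eq_div, h1, div_self]
      have := ψ.map_add_eq_mul (A * D.mres (Y v)).trace (-(A * D.mres (Y v)).trace)
      rw [add_neg_cancel, AddChar.map_zero_eq_one] at this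
      exact left_ne_zero_of_mul_eq_one this.symm
    ext1
    ext1
    rw [hY, hY, (D.unif_smul_eq_iff _ _).2 h]
  have := (linearIndependent_monoidHom (Multiplicative (Matrix n n k)) K).comp e hinj
  have heq : (fun u : (D.unitsRes (n := n)).ker => f.toFun u) = fun u A =>
      e u (Multiplicative.ofAdd A) := by
    ext u A
    exact hf u A (Y u) (hY u)
  rw [heq]
  exact this

lemma card_mul_card_le [Finite R] (D : LengthTwoData R k) :
    Nat.card (Matrix n n k)ˣ * Nat.card (Matrix n n k) ≤ Nat.card (Matrix n n R)ˣ := by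
  rw [← Nat.card_prod]
  refine Nat.card_le_card_of_injective (fun x : (Matrix n n k)ˣ × Matrix n n k =>
    (D.isUnit_of_isUnit_mres (M := (1 + D.unif • D.mteich x.2)) (by simp [mres_one_add])).unit *
      (D.isUnit_mteich x.1.isUnit).unit) ?_
  rintro ⟨γ, Y⟩ ⟨γ', Y'⟩ h
  have h1 : γ = γ' := by
    ext1
    simpa [mres_one_add] using congrArg (fun g => D.mres g.1) h
  subst h1
  have h2 := congrArg Units.val (mul_right_cancel h)
  simp only [IsUnit.unit_spec, add_right_inj, unif_smul_eq_iff, mres_mteich] at h2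
  rw [h2]

end LengthTwoData

/-- Matrix groups over two length-two rings with the same finite residue field have isomorphic group
algebras, as soon as both rings extend to length-two rings with algebraically closed residue
field. -/
theorem LengthTwoData.nonempty_algEquiv {R₁ R₂ S₁ S₂ k k' K n : Type*} [CommRing R₁] [CommRing R₂]
    [CommRing S₁] [CommRing S₂] [Field k] [Field k'] [Field K] [IsAlgClosed k'] [Fintype n]
    [DecidableEq n] [Finite R₁] [Finite R₂] [Finite k]
    (D₁ : LengthTwoData R₁ k) (D₂ : LengthTwoData R₂ k)
    (E₁ : LengthTwoData S₁ k') (E₂ : LengthTwoData S₂ k') (ι : k →+* k')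
    (φ₁ : R₁ →+* S₁) (hres₁ : ∀ r, E₁.res (φ₁ r) = ι (D₁.res r)) (hunif₁ : φ₁ D₁.unif = E₁.unif)
    (φ₂ : R₂ →+* S₂) (hres₂ : ∀ r, E₂.res (φ₂ r) = ι (D₂.res r)) (hunif₂ : φ₂ D₂.unif = E₂.unif)
    (ψ : AddChar k' K) (hψ : ∃ c, ψ (ι c) ≠ 1) :
    Nonempty (MonoidAlgebra K (Matrix n n R₁)ˣ ≃ₐ[K] MonoidAlgebra K (Matrix n n R₂)ˣ) := by
  classical
  have := Fintype.ofFinite k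
  obtain ⟨f₁, hf₁⟩ := D₁.exists_cocycle (n := n) E₁ φ₁ ι hres₁ hunif₁ ψ
  obtain ⟨f₂, hf₂⟩ := D₂.exists_cocycle (n := n) E₂ φ₂ ι hres₂ hunif₂ ψ
  exact f₁.nonempty_algEquiv f₂
    (D₁.linearIndependent_cocycle (ψ.compAddMonoidHom ι.toAddMonoidHom) hψ f₁ hf₁)
    (D₂.linearIndependent_cocycle (ψ.compAddMonoidHom ι.toAddMonoidHom) hψ f₂ hf₂)
    D₁.card_mul_card_le D₂.card_mul_card_le

lemma AddChar.exists_apply_one_ne_one (p : ℕ) [Fact p.Prime] (k K : Type*) [Field k] [CharP k p]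
    [Field K] [IsAlgClosed K] (hK : ringChar K ≠ p) : ∃ ψ : AddChar k K, ψ 1 ≠ 1 := by
  have hp := Fact.out (p := p.Prime)
  have : NeZero (p : K) := ⟨fun h => by
    have h1 := ringChar.dvd h
    rcases (Nat.dvd_prime hp).1 h1 with h2 | h2
    · exact CharP.ringChar_ne_one h2
    · exact hK h2⟩
  obtain ⟨ζ, hζ⟩ := HasEnoughRootsOfUnity.exists_primitiveRoot K p
  let := ZMod.algebra k p
  obtain ⟨θ, hθ⟩ := LinearMap.exists_leftInverse_of_injective (Algebra.linearMap (ZMod p) k)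
    (LinearMap.ker_eq_bot.2 (algebraMap (ZMod p) k).injective)
  have hθ1 : θ 1 = 1 := by simpa using LinearMap.congr_fun hθ 1
  refine ⟨(AddChar.zmodChar p hζ.pow_eq_one).compAddMonoidHom θ.toAddMonoidHom, ?_⟩
  have h1 : (AddChar.zmodChar p hζ.pow_eq_one) 1 = ζ := by
    simpa using AddChar.zmodChar_apply' hζ.pow_eq_one 1
  simpa [hθ1, h1] using hζ.ne_one hp.one_lt

namespace DualNumber

/-- The dual numbers over a field. -/
def lengthTwoData (k : Type*) [Field k] : LengthTwoData (DualNumber k) k where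
  res := TrivSqZeroExt.fstHom k k k
  unif := DualNumber.eps
  teich := (TrivSqZeroExt.inlHom k k).toMonoidWithZeroHom
  res_teich := TrivSqZeroExt.fst_inl k
  res_eq_zero_iff r := by
    constructor
    · intro h
      exact ⟨TrivSqZeroExt.inl r.snd, by ext <;> simp_all⟩
    · rintro ⟨y, rfl⟩
      simp
  unif_mul_eq_zero_iff y := by simp [TrivSqZeroExt.ext_iff]

/-- The map of dual numbers induced by a ring homomorphism. -/
def mapRingHom {k k' : Type*} [CommRing k] [CommRing k'] (ι : k →+* k') :
    DualNumber k →+* DualNumber k' where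
  toFun x := TrivSqZeroExt.inl (ι x.fst) + TrivSqZeroExt.inr (ι x.snd)
  map_one' := by ext <;> simp
  map_zero' := by ext <;> simp
  map_add' x y := by ext <;> simp
  map_mul' x y := by ext <;> simp

end DualNumber

namespace TruncatedWittVector

variable (p : ℕ) [Fact p.Prime]

/-- The constant coefficient of a Witt vector of length two. -/
noncomputable def constantCoeff (k : Type*) [CommRing k] : TruncatedWittVector p 2 k →+* k :=
  (WittVector.truncate 2).liftOfSurjective (WittVector.truncate_surjective p 2 k)
    ⟨WittVector.constantCoeff, fun x hx => (WittVector.mem_ker_truncate 2 x).1 hx 0 (by simp)⟩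

lemma constantCoeff_truncate {k : Type*} [CommRing k] (x : WittVector p k) :
    constantCoeff p k (WittVector.truncate 2 x) = x.coeff 0 := by
  rw [constantCoeff, RingHom.liftOfSurjective_comp_apply]
  rfl

lemma natCast_mul_truncate {k : Type*} [CommRing k] (x : WittVector p k) :
    (p : TruncatedWittVector p 2 k) * WittVector.truncate 2 x =
      WittVector.truncate 2 (x * (p : WittVector p k)) := by
  rw [map_mul, map_natCast, mul_comm]

/-- Witt vectors of length two over a perfect field of characteristic `p`. -/
noncomputable def lengthTwoData (k : Type*) [Field k] [CharP k p] [PerfectRing k p] :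
    LengthTwoData (TruncatedWittVector p 2 k) k where
  res := constantCoeff p k
  unif := p
  teich :=
    { toFun x := WittVector.truncate 2 (WittVector.teichmuller p x)
      map_one' := by simp
      map_zero' := by simp
      map_mul' x y := by simp }
  res_teich x := (constantCoeff_truncate p _).trans (WittVector.teichmuller_coeff_zero p x)
  res_eq_zero_iff r := by
    obtain ⟨x, rfl⟩ := WittVector.truncate_surjective p 2 k r
    rw [constantCoeff_truncate]
    constructor
    · intro h
      refine ⟨WittVector.truncate 2 (.mk p fun i => (frobeniusEquiv k p).symm (x.coeff (i + 1))), ?_⟩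
      rw [natCast_mul_truncate]
      congr 1
      ext i
      cases i with
      | zero => rw [WittVector.mul_charP_coeff_zero]; exact h
      | succ i => simp [WittVector.mul_charP_coeff_succ]
    · rintro ⟨y, hy⟩
      obtain ⟨y, rfl⟩ := WittVector.truncate_surjective p 2 k y
      have := congrArg (TruncatedWittVector.coeff 0) hy
      rw [natCast_mul_truncate, WittVector.coeff_truncate, WittVector.coeff_truncate] at this
      exact this.trans (WittVector.mul_charP_coeff_zero y)
  unif_mul_eq_zero_iff y := by
    obtain ⟨y, rfl⟩ := WittVector.truncate_surjective p 2 k y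
    rw [constantCoeff_truncate, natCast_mul_truncate, ← RingHom.mem_ker,
      WittVector.mem_ker_truncate]
    have h₁ := WittVector.mul_charP_coeff_succ y 0
    rw [zero_add] at h₁
    constructor
    · intro h
      rw [h 1 (by simp)] at h₁
      exact eq_zero_of_pow_eq_zero h₁.symm
    · intro h i hi
      interval_cases i
      · exact WittVector.mul_charP_coeff_zero y
      · rw [h₁, h, zero_pow (Fact.out : p.Prime).ne_zero]

/-- The map of truncated Witt vectors induced by a ring homomorphism. -/
noncomputable def mapRingHom (m : ℕ) {k k' : Type*} [CommRing k] [CommRing k'] (ι : k →+* k') :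
    TruncatedWittVector p m k →+* TruncatedWittVector p m k' :=
  (WittVector.truncate m).liftOfSurjective (WittVector.truncate_surjective p m k)
    ⟨(WittVector.truncate m).comp (WittVector.map ι), fun x hx => by
      rw [WittVector.mem_ker_truncate] at hx
      rw [RingHom.mem_ker, RingHom.comp_apply, ← RingHom.mem_ker, WittVector.mem_ker_truncate]
      intro i hi
      rw [WittVector.map_coeff, hx i hi, map_zero]⟩

lemma mapRingHom_truncate (m : ℕ) {k k' : Type*} [CommRing k] [CommRing k'] (ι : k →+* k')
    (x : WittVector p k) : mapRingHom p m ι (WittVector.truncate m x) =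
      WittVector.truncate m (WittVector.map ι x) := by
  rw [mapRingHom, RingHom.liftOfSurjective_comp_apply]
  rfl

end TruncatedWittVector

/-- **Theorem 5.4 for `GLₙ`, explicit rings.** For `q = p ^ d` and `K` algebraically closed
with `char K ≠ p`, the group algebras `K[GLₙ(𝔽_q[t]/t²)]` and `K[GLₙ(W₂(𝔽_q))]` are
isomorphic as `K`-algebras. -/
theorem group_algebra_iso_GL_dualNumber_wittVector
    (p d n : ℕ) [Fact p.Prime] (hd : 1 ≤ d) (hn : 1 ≤ n) (q : ℕ) (hq : q = p ^ d)
    (K : Type*) [Field K] [IsAlgClosed K] (hK : ringChar K ≠ p) :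
    Nonempty (MonoidAlgebra K (GL (Fin n) (DualNumber (GaloisField p d))) ≃ₐ[K]
      MonoidAlgebra K (GL (Fin n) (TruncatedWittVector p 2 (GaloisField p d)))) := by
  have : CharP (AlgebraicClosure (GaloisField p d)) p := charP_of_injective_algebraMap
    (algebraMap (GaloisField p d) _).injective p
  have : Finite (DualNumber (GaloisField p d)) :=
    inferInstanceAs (Finite (GaloisField p d × GaloisField p d))
  have : Finite (TruncatedWittVector p 2 (GaloisField p d)) :=
    inferInstanceAs (Finite (Fin 2 → GaloisField p d))
  obtain ⟨ψ, hψ⟩ := AddChar.exists_apply_one_ne_one p (AlgebraicClosure (GaloisField p d)) K hK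
  let ι := algebraMap (GaloisField p d) (AlgebraicClosure (GaloisField p d))
  refine LengthTwoData.nonempty_algEquiv (DualNumber.lengthTwoData _)
    (TruncatedWittVector.lengthTwoData p _) (DualNumber.lengthTwoData _)
    (TruncatedWittVector.lengthTwoData p _) ι
    (DualNumber.mapRingHom ι) (fun r => ?_) ?_
    (TruncatedWittVector.mapRingHom p 2 ι) (fun r => ?_) ?_ ψ ⟨1, by rwa [map_one]⟩
  · simp [DualNumber.lengthTwoData, DualNumber.mapRingHom]
  · ext <;> simp [DualNumber.lengthTwoData, DualNumber.mapRingHom]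
  · obtain ⟨x, rfl⟩ := WittVector.truncate_surjective p 2 _ r
    rw [TruncatedWittVector.mapRingHom_truncate]
    refine (TruncatedWittVector.constantCoeff_truncate p _).trans ?_
    rw [WittVector.map_coeff]
    exact congrArg ι (TruncatedWittVector.constantCoeff_truncate p x).symm
  · simp [TruncatedWittVector.lengthTwoData]
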